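/- arXiv:1901.04724 — 2 statements merged into one kernel-verified Lean document; each statement's English description precedes it below -/
import Mathlib

section
/- Let 𝒞 = ⋂_{K,L∈ℕ} 𝒞_{K,L}, where for K, L ∈ ℕ, 𝒞_{K,L} is the set of irrational α ∈ (0,1) for which there exist an increasing sequence (n_k) of natural numbers and a constant c > 0 such that a_{n_k+1-n} ≤ e^{cn} for every 1 ≤ n ≤ n_k, and 100(K²+L²) < a_{n_k+1} < 200(K²+L²), where (a_n) is the continued fraction expansion of α. Then 𝒞 has full Lebesgue measure in (0,1). -/
open MeasureTheory Filter Topology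

noncomputable section

/-- Iterates of the Gauss map applied to the fractional part of `α`. -/
def gaussIter (α : ℝ) (n : ℕ) : ℝ := (fun x : ℝ => Int.fract x⁻¹)^[n] (Int.fract α)

/-- The `n`-th partial quotient `a_n` of the continued fraction expansion of `α`
(for `n ≥ 1`). -/
def cfA (α : ℝ) (n : ℕ) : ℕ := ⌊(gaussIter α (n - 1))⁻¹⌋₊

/-- The denominators `q_n` of the convergents of the continued fraction of `α`:
`q₀ = 1`, `q₁ = a₁`, `q_{n+1} = a_{n+1} q_n + q_{n-1}`. -/
def cfQ (α : ℝ) : ℕ → ℕ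
  | 0 => 1
  | 1 => cfA α 1
  | n + 2 => cfA α (n + 2) * cfQ α (n + 1) + cfQ α n

/-- Birkhoff sums over the rotation by `α`: `S_n(φ)(x) = ∑_{i<n} φ(x + iα)`. -/
def birkhoffRot (α : ℝ) (φ : ℝ → ℝ) (n : ℕ) (x : ℝ) : ℝ :=
  ∑ i ∈ Finset.range n, φ (x + i * α)

/-- Distance to the nearest integer, `‖x‖ = min(x mod 1, 1 - x mod 1)`. -/
def distNearestInt (x : ℝ) : ℝ := min (Int.fract x) (1 - Int.fract x)

/-- The set `𝒞_{K,L}` of irrational `α ∈ (0,1)` admitting an increasing sequence `(n_k)`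
and a constant `c > 0` with `a_{n_k+1-n} ≤ e^{cn}` for every `1 ≤ n ≤ n_k` and
`100(K²+L²) < a_{n_k+1} < 200(K²+L²)`. -/
def CKL (K L : ℕ) : Set ℝ :=
  {α | α ∈ Set.Ioo (0 : ℝ) 1 ∧ Irrational α ∧
    ∃ nk : ℕ → ℕ, StrictMono nk ∧ ∃ c > (0 : ℝ),
      ∀ k : ℕ,
        (∀ n : ℕ, 1 ≤ n → n ≤ nk k → (cfA α (nk k + 1 - n) : ℝ) ≤ Real.exp (c * n)) ∧
        100 * (K ^ 2 + L ^ 2) < cfA α (nk k + 1) ∧ cfA α (nk k + 1) < 200 * (K ^ 2 + L ^ 2)}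

/-- The Gauss map `x ↦ 1/x mod 1`. -/
def gaussMap (x : ℝ) : ℝ := Int.fract x⁻¹

/-- The first partial quotient `⌊1/x⌋`. -/
def firstDigit (x : ℝ) : ℕ := ⌊x⁻¹⌋₊

/-- The density `(1+s)/(1+sx)²`; for `s ∈ [0,1]` these are, up to scaling, the densities of the
Gauss iterates conditioned on a cylinder. -/
def cylDensity (s x : ℝ) : ℝ := (1 + s) / (1 + s * x) ^ 2

/-- The probability measure on `(0,1]` with density `cylDensity s`. -/
def cylMeasure (s : ℝ) : Measure ℝ :=
  (volume.restrict (Set.Ioc (0 : ℝ) 1)).withDensity fun x => ENNReal.ofReal (cylDensity s x)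

lemma measurable_gaussMap : Measurable gaussMap :=
  measurable_fract.comp measurable_inv

lemma measurable_firstDigit : Measurable firstDigit :=
  Nat.measurable_floor.comp measurable_inv

lemma measurable_cylDensity (s : ℝ) :
    Measurable fun x => ENNReal.ofReal (cylDensity s x) := by
  unfold cylDensity
  fun_prop

lemma cylMeasure_apply (s : ℝ) {A : Set ℝ} (hA : MeasurableSet A) :
    cylMeasure s A = ∫⁻ x in A ∩ Set.Ioc 0 1, ENNReal.ofReal (cylDensity s x) := by
  rw [cylMeasure, withDensity_apply _ hA, Measure.restrict_restrict hA]

lemma cylMeasure_univ {s : ℝ} (hs : s ∈ Set.Icc (0 : ℝ) 1) : cylMeasure s Set.univ = 1 := by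
  have hs0 := hs.1
  have hpos : ∀ x ∈ Set.Icc (0 : ℝ) 1, 0 < 1 + s * x := fun x hx => by
    nlinarith [mul_nonneg hs0 hx.1]
  have hcont : ContinuousOn (cylDensity s) (Set.Icc 0 1) := by
    unfold cylDensity
    exact continuousOn_const.div (by fun_prop) fun x hx => (pow_pos (hpos x hx) 2).ne'
  rw [cylMeasure_apply s MeasurableSet.univ, Set.univ_inter,
    ← ofReal_integral_eq_lintegral_ofReal
      (hcont.integrableOn_Icc.mono_set Set.Ioc_subset_Icc_self)]
  · rw [← intervalIntegral.integral_of_le zero_le_one,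
      intervalIntegral.integral_eq_sub_of_hasDerivAt
        (f := fun x => (1 + s) * x / (1 + s * x))]
    · have : (1 + s) ≠ 0 := by positivity
      simp [this]
    · intro x hx
      rw [Set.uIcc_of_le zero_le_one] at hx
      have h := hpos x hx
      have h1 : HasDerivAt (fun x : ℝ => (1 + s) * x) (1 + s) x := by
        simpa using (hasDerivAt_id x).const_mul (1 + s)
      have h2 : HasDerivAt (fun x : ℝ => 1 + s * x) s x := by
        simpa using ((hasDerivAt_id x).const_mul s).const_add 1
      refine (h1.div h2 h.ne').congr_deriv ?_
      unfold cylDensity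
      congr 1
      ring
    · rw [intervalIntegrable_iff_integrableOn_Icc_of_le zero_le_one]
      exact hcont.integrableOn_Icc
  · filter_upwards with x
    unfold cylDensity
    simp only [Pi.zero_apply]
    positivity

lemma cylMeasure_le_two_mul_volume {s : ℝ} (hs : s ∈ Set.Icc (0 : ℝ) 1) {A : Set ℝ}
    (hA : MeasurableSet A) : cylMeasure s A ≤ 2 * volume (A ∩ Set.Ioc 0 1) := by
  rw [cylMeasure_apply s hA, ← setLIntegral_const]
  refine setLIntegral_mono measurable_const fun x hx => ?_
  rw [← ENNReal.ofReal_ofNat]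
  apply ENNReal.ofReal_le_ofReal
  have h0 := mul_nonneg hs.1 hx.2.1.le
  rw [cylDensity, div_le_iff₀ (by positivity)]
  nlinarith [hs.2]

lemma volume_le_two_mul_cylMeasure {s : ℝ} (hs : s ∈ Set.Icc (0 : ℝ) 1) {A : Set ℝ}
    (hA : MeasurableSet A) : 2⁻¹ * volume (A ∩ Set.Ioc 0 1) ≤ cylMeasure s A := by
  rw [cylMeasure_apply s hA, ← setLIntegral_const]
  refine setLIntegral_mono (measurable_cylDensity s) fun x hx => ?_
  rw [← ENNReal.ofReal_ofNat, ← ENNReal.ofReal_inv_of_pos two_pos]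
  apply ENNReal.ofReal_le_ofReal
  have h0 := mul_nonneg hs.1 hx.2.1.le
  have h1 : s * x ≤ s := mul_le_of_le_one_right hs.1 hx.2.2
  rw [cylDensity, le_div_iff₀ (by positivity)]
  nlinarith [hs.1, hs.2]

lemma preimage_gaussMap_inter_digit {a : ℕ} (ha : 1 ≤ a) (A : Set ℝ) :
    (gaussMap ⁻¹' A ∩ firstDigit ⁻¹' {a}) ∩ Set.Ioc 0 1 =
      (fun y : ℝ => ((a : ℝ) + y)⁻¹) '' (A ∩ Set.Ico 0 1) := by
  have ha' : (1 : ℝ) ≤ a := by exact_mod_cast ha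
  ext x
  constructor
  · rintro ⟨⟨hT, hd⟩, hx0, -⟩
    have hinv : 0 ≤ x⁻¹ := (inv_pos.2 hx0).le
    have hfl : (⌊x⁻¹⌋₊ : ℝ) = a := by
      simpa [firstDigit] using hd
    have hfr : gaussMap x = x⁻¹ - a := by
      rw [gaussMap, ← hfl, Int.fract, natCast_floor_eq_intCast_floor hinv]
    refine ⟨gaussMap x, ⟨hT, Int.fract_nonneg _, Int.fract_lt_one _⟩, ?_⟩
    simp [hfr]
  · rintro ⟨y, ⟨hA, hy0, hy1⟩, rfl⟩
    have hfl : ⌊(a : ℝ) + y⌋ = a := by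
      rw [Int.floor_eq_iff]
      push_cast
      constructor <;> linarith
    refine ⟨⟨?_, ?_⟩, by positivity, inv_le_one_of_one_le₀ (by linarith)⟩
    · have : gaussMap ((a : ℝ) + y)⁻¹ = y := by
        rw [gaussMap, inv_inv, Int.fract, hfl]
        push_cast
        ring
      simpa [this] using hA
    · simp only [firstDigit, Set.mem_preimage, inv_inv, Set.mem_singleton_iff]
      rw [Nat.floor_eq_iff (by positivity)]
      constructor <;> linarith

lemma cylMeasure_gaussMap_inter_digit {s : ℝ} (hs : s ∈ Set.Icc (0 : ℝ) 1) {a : ℕ} (ha : 1 ≤ a)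
    {A : Set ℝ} (hA : MeasurableSet A) :
    cylMeasure s (gaussMap ⁻¹' A ∩ firstDigit ⁻¹' {a}) =
      ENNReal.ofReal ((1 + s) / ((a + s) * (a + s + 1))) * cylMeasure (1 / (a + s)) A := by
  have ha' : (1 : ℝ) ≤ a := by exact_mod_cast ha
  have hs0 := hs.1
  rw [cylMeasure_apply s ((measurable_gaussMap hA).inter
      (measurable_firstDigit (MeasurableSet.singleton a))),
    preimage_gaussMap_inter_digit ha,
    lintegral_image_eq_lintegral_abs_deriv_mul (hA.inter measurableSet_Ico)
      (f' := fun y => -1 / ((a : ℝ) + y) ^ 2), cylMeasure_apply _ hA,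
    ← lintegral_const_mul _ (measurable_cylDensity _)]
  · have hset : (A ∩ Set.Ico (0 : ℝ) 1 : Set ℝ) =ᵐ[volume] (A ∩ Set.Ioc 0 1 : Set ℝ) :=
      (ae_eq_refl A).inter Ico_ae_eq_Ioc
    rw [setLIntegral_congr hset]
    refine setLIntegral_congr_fun (hA.inter measurableSet_Ioc) fun y hy => ?_
    have hy0 := hy.2.1
    rw [← ENNReal.ofReal_mul (abs_nonneg _), ← ENNReal.ofReal_mul (by positivity)]
    congr 1
    rw [abs_div, abs_neg, abs_one, abs_of_pos (by positivity : 0 < ((a : ℝ) + y) ^ 2)]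
    unfold cylDensity
    have h1 : (a : ℝ) + y ≠ 0 := by positivity
    have h2 : (a : ℝ) + s ≠ 0 := by positivity
    have h3 : (a : ℝ) + s + 1 ≠ 0 := by positivity
    have h4 : (a : ℝ) + y + s ≠ 0 := by positivity
    have e1 : 1 + s * ((a : ℝ) + y)⁻¹ = (a + y + s) / (a + y) := by field_simp
    have e2 : 1 + 1 / ((a : ℝ) + s) * y = (a + y + s) / (a + s) := by field_simp; ring
    have e3 : 1 + 1 / ((a : ℝ) + s) = (a + s + 1) / (a + s) := by field_simp
    rw [e1, e2, e3]
    field_simp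
  · intro y hy
    have hy0 := hy.2.1
    have h1 : (a : ℝ) + y ≠ 0 := by positivity
    exact (((hasDerivAt_id y).const_add (a : ℝ)).inv h1).hasDerivWithinAt
  · intro y _ z _ h
    simpa using h

lemma cylMeasure_gaussMap_inter_digit_le {κ : ENNReal} {A : Set ℝ} (hA : MeasurableSet A)
    (hκ : ∀ s ∈ Set.Icc (0 : ℝ) 1, cylMeasure s A ≤ κ) {s : ℝ} (hs : s ∈ Set.Icc (0 : ℝ) 1)
    (S : Set ℕ) :
    cylMeasure s (gaussMap ⁻¹' A ∩ firstDigit ⁻¹' S) ≤ κ * cylMeasure s (firstDigit ⁻¹' S) := by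
  have hdisj : ∀ B : Set ℝ, S.PairwiseDisjoint fun a => B ∩ firstDigit ⁻¹' {a} := by
    intro B a _ b _ hab
    refine Set.disjoint_left.2 fun x hx hx' => hab ?_
    exact hx.2.symm.trans hx'.2
  have hmeas : ∀ B : Set ℝ, MeasurableSet B → ∀ a ∈ S,
      MeasurableSet (B ∩ firstDigit ⁻¹' {a}) :=
    fun B hB a _ => hB.inter (measurable_firstDigit (MeasurableSet.singleton a))
  have hunion : ∀ B : Set ℝ,
      B ∩ firstDigit ⁻¹' S = ⋃ a ∈ S, B ∩ firstDigit ⁻¹' {a} := by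
    intro B
    ext x
    simp
  rw [hunion (gaussMap ⁻¹' A), ← Set.univ_inter (firstDigit ⁻¹' S), hunion Set.univ,
    measure_biUnion S.to_countable (hdisj _) (hmeas _ (measurable_gaussMap hA)),
    measure_biUnion S.to_countable (hdisj _) (hmeas _ MeasurableSet.univ),
    ← ENNReal.tsum_mul_left]
  refine ENNReal.tsum_le_tsum fun ⟨a, _⟩ => ?_
  rcases Nat.eq_zero_or_pos a with rfl | ha
  · have h0 : cylMeasure s (gaussMap ⁻¹' A ∩ firstDigit ⁻¹' {0}) = 0 := by
      rw [cylMeasure_apply s ((measurable_gaussMap hA).inter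
        (measurable_firstDigit (MeasurableSet.singleton 0)))]
      have : (gaussMap ⁻¹' A ∩ firstDigit ⁻¹' {0}) ∩ Set.Ioc 0 1 = ∅ := by
        refine Set.eq_empty_of_forall_notMem ?_
        rintro x ⟨⟨-, hx⟩, hx0, hx1⟩
        simp only [firstDigit, Set.mem_preimage, Set.mem_singleton_iff, Nat.floor_eq_zero] at hx
        exact absurd ((one_le_inv₀ hx0).2 hx1) (not_le.2 hx)
      simp [this]
    simp [h0]
  · have ha' : (1 : ℝ) ≤ a := by exact_mod_cast ha
    have hs' : 1 / ((a : ℝ) + s) ∈ Set.Icc (0 : ℝ) 1 := by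
      have := hs.1
      refine ⟨by positivity, ?_⟩
      rw [div_le_one (by positivity)]
      linarith
    rw [cylMeasure_gaussMap_inter_digit hs ha hA, ← Set.preimage_univ (f := gaussMap),
      cylMeasure_gaussMap_inter_digit hs ha MeasurableSet.univ, cylMeasure_univ hs', mul_one,
      mul_comm]
    gcongr
    exact hκ _ hs'

lemma cylMeasure_preimage_iterate_le {κ : ENNReal} {A : Set ℝ} (hA : MeasurableSet A)
    (hκ : ∀ s ∈ Set.Icc (0 : ℝ) 1, cylMeasure s A ≤ κ) (n : ℕ) :
    ∀ s ∈ Set.Icc (0 : ℝ) 1, cylMeasure s (gaussMap^[n] ⁻¹' A) ≤ κ := by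
  induction n with
  | zero => simpa using hκ
  | succ n ih =>
    intro s hs
    have h := cylMeasure_gaussMap_inter_digit_le ((measurable_gaussMap.iterate n) hA) ih hs
      Set.univ
    rwa [Set.preimage_univ, Set.inter_univ, cylMeasure_univ hs, mul_one, ← Set.preimage_comp,
      ← Function.iterate_succ] at h

/-- The points none of whose first `B` partial quotients lie in `S`. -/
def digitsAvoid (S : Set ℕ) (B : ℕ) : Set ℝ :=
  {x | ∀ m < B, firstDigit (gaussMap^[m] x) ∉ S}

lemma measurableSet_digitsAvoid (S : Set ℕ) (B : ℕ) : MeasurableSet (digitsAvoid S B) := by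
  have : digitsAvoid S B =
      ⋂ m, ⋂ (_ : m < B), (fun x => firstDigit (gaussMap^[m] x)) ⁻¹' Sᶜ := by
    ext x
    simp [digitsAvoid]
  rw [this]
  refine MeasurableSet.iInter fun m => MeasurableSet.iInter fun _ => ?_
  exact (measurable_firstDigit.comp (measurable_gaussMap.iterate m)) trivial

lemma cylMeasure_digitsAvoid_le {S : Set ℕ} {ρ : ENNReal}
    (hρ : ∀ s ∈ Set.Icc (0 : ℝ) 1, cylMeasure s (firstDigit ⁻¹' Sᶜ) ≤ ρ) (B : ℕ) :
    ∀ s ∈ Set.Icc (0 : ℝ) 1, cylMeasure s (digitsAvoid S B) ≤ ρ ^ B := by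
  induction B with
  | zero =>
    intro s hs
    simpa [cylMeasure_univ hs] using measure_mono (μ := cylMeasure s) (digitsAvoid S 0).subset_univ
  | succ B ih =>
    intro s hs
    have hset : digitsAvoid S (B + 1) ⊆
        gaussMap ⁻¹' digitsAvoid S B ∩ firstDigit ⁻¹' Sᶜ := by
      intro x hx
      refine ⟨fun m hm => ?_, hx 0 B.succ_pos⟩
      rw [← Function.iterate_succ_apply]
      exact hx (m + 1) (by omega)
    calc cylMeasure s (digitsAvoid S (B + 1))
        ≤ cylMeasure s (gaussMap ⁻¹' digitsAvoid S B ∩ firstDigit ⁻¹' Sᶜ) := measure_mono hset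
      _ ≤ ρ ^ B * cylMeasure s (firstDigit ⁻¹' Sᶜ) :=
          cylMeasure_gaussMap_inter_digit_le (measurableSet_digitsAvoid S B) ih hs _
      _ ≤ ρ ^ (B + 1) := by
          rw [pow_succ]
          gcongr
          exact hρ s hs

lemma exists_cylMeasure_compl_digit_le {S : Set ℕ} {a : ℕ} (ha : 1 ≤ a) (haS : a ∈ S) :
    ∃ ρ < (1 : ENNReal), ∀ s ∈ Set.Icc (0 : ℝ) 1, cylMeasure s (firstDigit ⁻¹' Sᶜ) ≤ ρ := by
  have hmeas : MeasurableSet (firstDigit ⁻¹' {a}) :=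
    measurable_firstDigit (MeasurableSet.singleton a)
  set δ : ENNReal := 2⁻¹ * volume (firstDigit ⁻¹' {a} ∩ Set.Ioc 0 1)
  have hpos : 0 < δ := by
    have ha' : (1 : ℝ) ≤ a := by exact_mod_cast ha
    have hsub : Set.Ioo ((a + 1 : ℝ)⁻¹) ((a : ℝ)⁻¹) ⊆ firstDigit ⁻¹' {a} ∩ Set.Ioc 0 1 := by
      intro x hx
      have hx0 : 0 < x := lt_trans (by positivity) hx.1
      have h1 : (a : ℝ) < x⁻¹ := (lt_inv_comm₀ hx0 (by positivity)).1 hx.2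
      have h2 : x⁻¹ < a + 1 := inv_lt_of_inv_lt₀ (by positivity) hx.1
      refine ⟨?_, hx0, hx.2.le.trans (inv_le_one_of_one_le₀ ha')⟩
      simp only [firstDigit, Set.mem_preimage, Set.mem_singleton_iff]
      rw [Nat.floor_eq_iff (by positivity)]
      exact ⟨h1.le, h2⟩
    have hlt : ((a + 1 : ℝ)⁻¹) < ((a : ℝ)⁻¹) := by
      gcongr
      linarith
    refine ENNReal.mul_pos (by simp) (ne_of_gt (lt_of_lt_of_le ?_ (measure_mono hsub)))
    simpa using hlt
  refine ⟨1 - δ, ENNReal.sub_lt_self ENNReal.one_ne_top one_ne_zero hpos.ne', fun s hs => ?_⟩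
  have hfin : IsFiniteMeasure (cylMeasure s) := ⟨by simp [cylMeasure_univ hs]⟩
  calc cylMeasure s (firstDigit ⁻¹' Sᶜ)
      ≤ cylMeasure s (firstDigit ⁻¹' {a})ᶜ := by
        refine measure_mono fun x hx hxa => hx ?_
        simpa [show firstDigit x = a from hxa] using haS
    _ = 1 - cylMeasure s (firstDigit ⁻¹' {a}) := by
        rw [measure_compl hmeas (measure_ne_top _ _), cylMeasure_univ hs]
    _ ≤ 1 - δ := tsub_le_tsub_left (volume_le_two_mul_cylMeasure hs hmeas) _

lemma cylMeasure_lt_firstDigit_le {t : ℝ} (ht : 0 < t) {s : ℝ} (hs : s ∈ Set.Icc (0 : ℝ) 1) :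
    cylMeasure s {x | t < firstDigit x} ≤ ENNReal.ofReal (2 * t⁻¹) := by
  have hmeas : MeasurableSet {x | t < (firstDigit x : ℝ)} :=
    measurableSet_lt measurable_const (measurable_from_nat.comp measurable_firstDigit)
  refine (cylMeasure_le_two_mul_volume hs hmeas).trans ?_
  rw [ENNReal.ofReal_mul zero_le_two, ENNReal.ofReal_ofNat]
  gcongr
  have hsub : {x | t < (firstDigit x : ℝ)} ∩ Set.Ioc 0 1 ⊆ Set.Ioc 0 t⁻¹ := by
    rintro x ⟨hx, hx0, -⟩
    refine ⟨hx0, (le_inv_comm₀ hx0 ht).2 ?_⟩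
    exact le_trans (le_of_lt hx) (Nat.floor_le (inv_pos.2 hx0).le)
  simpa using measure_mono (μ := volume) hsub

lemma sum_exp_neg_mul_le {c : ℝ} (hc : Real.exp (-c) ≤ 1 / 2) (m : ℕ) :
    ∑ n ∈ Finset.Icc 1 m, 2 * (Real.exp (c * n))⁻¹ ≤ 4 * Real.exp (-c) := by
  set r := Real.exp (-c) with hr
  have hr0 : 0 < r := Real.exp_pos _
  have hpow : ∀ n : ℕ, (Real.exp (c * n))⁻¹ = r ^ n := by
    intro n
    rw [hr, ← Real.exp_neg, ← Real.exp_nat_mul]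
    congr 1
    ring
  have key : ∀ m : ℕ, ∑ n ∈ Finset.Icc 1 m, 2 * r ^ n ≤ 4 * r - 4 * r ^ (m + 1) := by
    intro m
    induction m with
    | zero => simp
    | succ m ih =>
      rw [Finset.sum_Icc_succ_top (by omega), pow_succ r (m + 1)]
      nlinarith [pow_pos hr0 (m + 1)]
  simp only [hpow]
  exact (key m).trans (by linarith [pow_pos hr0 (m + 1)])

/-- The points `x` for which, at index `m`, the earlier partial quotients grow at most like
`e^{cn}` looking backwards and the next partial quotient lies in `S`. -/
def goodIndex (S : Set ℕ) (c : ℝ) (m : ℕ) (x : ℝ) : Prop :=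
  (∀ n : ℕ, 1 ≤ n → n ≤ m → (firstDigit (gaussMap^[m - n] x) : ℝ) ≤ Real.exp (c * n)) ∧
    firstDigit (gaussMap^[m] x) ∈ S

lemma cylMeasure_not_goodIndex_le {S : Set ℕ} {ρ : ENNReal}
    (hρ : ∀ s ∈ Set.Icc (0 : ℝ) 1, cylMeasure s (firstDigit ⁻¹' Sᶜ) ≤ ρ)
    {c : ℝ} (hc : Real.exp (-c) ≤ 1 / 2) (J B : ℕ) {s : ℝ} (hs : s ∈ Set.Icc (0 : ℝ) 1) :
    cylMeasure s {x | ∀ m, J ≤ m → ¬ goodIndex S c m x} ≤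
      ρ ^ B + B * ENNReal.ofReal (4 * Real.exp (-c)) := by
  have hsub : {x | ∀ m, J ≤ m → ¬ goodIndex S c m x} ⊆
      gaussMap^[J] ⁻¹' digitsAvoid S B ∪ ⋃ i ∈ Finset.range B, ⋃ n ∈ Finset.Icc 1 (J + i),
        gaussMap^[J + i - n] ⁻¹' {x | Real.exp (c * n) < firstDigit x} := by
    intro x hx
    by_contra hcon
    simp only [Set.mem_union, not_or, Set.mem_iUnion, not_exists, Set.mem_preimage,
      Set.mem_ofPred_eq, not_lt, Finset.mem_range, Finset.mem_Icc] at hcon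
    obtain ⟨h1, h2⟩ := hcon
    simp only [digitsAvoid, Set.mem_ofPred_eq, not_forall, not_not] at h1
    obtain ⟨i, hi, hiS⟩ := h1
    rw [← Function.iterate_add_apply, add_comm] at hiS
    exact hx (J + i) (by omega) ⟨fun n hn hn' => h2 i hi n ⟨hn, hn'⟩, hiS⟩
  refine (measure_mono hsub).trans ((measure_union_le _ _).trans (add_le_add ?_ ?_))
  · exact cylMeasure_preimage_iterate_le (measurableSet_digitsAvoid S B)
      (cylMeasure_digitsAvoid_le hρ B) J s hs
  · refine (measure_biUnion_finset_le _ _).trans ?_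
    have hone : ∀ i ∈ Finset.range B, cylMeasure s (⋃ n ∈ Finset.Icc 1 (J + i),
        gaussMap^[J + i - n] ⁻¹' {x | Real.exp (c * n) < firstDigit x}) ≤
          ENNReal.ofReal (4 * Real.exp (-c)) := by
      intro i _
      refine (measure_biUnion_finset_le _ _).trans ?_
      refine le_trans ?_ (ENNReal.ofReal_le_ofReal (sum_exp_neg_mul_le hc (J + i)))
      rw [ENNReal.ofReal_sum_of_nonneg fun n _ => by positivity]
      refine Finset.sum_le_sum fun n _ => ?_
      exact cylMeasure_preimage_iterate_le
        (measurableSet_lt measurable_const (measurable_from_nat.comp measurable_firstDigit))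
        (fun s hs => cylMeasure_lt_firstDigit_le (Real.exp_pos _) hs) _ s hs
    simpa using Finset.sum_le_sum hone

lemma cylMeasure_eventually_not_goodIndex {S : Set ℕ} {a : ℕ} (ha : 1 ≤ a) (haS : a ∈ S)
    {s : ℝ} (hs : s ∈ Set.Icc (0 : ℝ) 1) :
    cylMeasure s {x | ∀ c > 0, ∀ᶠ m in atTop, ¬ goodIndex S c m x} = 0 := by
  obtain ⟨ρ, hρ1, hρ⟩ := exists_cylMeasure_compl_digit_le ha haS
  have hbound : ∀ (c : ℝ), 0 < c → Real.exp (-c) ≤ 1 / 2 → ∀ B : ℕ,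
      cylMeasure s {x | ∀ c > 0, ∀ᶠ m in atTop, ¬ goodIndex S c m x} ≤
        ρ ^ B + B * ENNReal.ofReal (4 * Real.exp (-c)) := by
    intro c hc0 hc B
    have hsub : {x | ∀ c > 0, ∀ᶠ m in atTop, ¬ goodIndex S c m x} ⊆
        ⋃ J : ℕ, {x | ∀ m, J ≤ m → ¬ goodIndex S c m x} := by
      intro x hx
      simpa using eventually_atTop.1 (hx c hc0)
    have hmono : Monotone fun J : ℕ => {x | ∀ m, J ≤ m → ¬ goodIndex S c m x} :=
      fun J J' hJ x hx m hm => hx m (hJ.trans hm)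
    refine (measure_mono hsub).trans ?_
    rw [hmono.measure_iUnion]
    exact iSup_le fun J => cylMeasure_not_goodIndex_le hρ hc J B hs
  have hexp : Tendsto (fun c : ℝ => Real.exp (-c)) atTop (𝓝 0) :=
    Real.tendsto_exp_neg_atTop_nhds_zero
  have hpow : ∀ B : ℕ,
      cylMeasure s {x | ∀ c > 0, ∀ᶠ m in atTop, ¬ goodIndex S c m x} ≤ ρ ^ B := by
    intro B
    have hlim : Tendsto (fun c : ℝ => ρ ^ B + B * ENNReal.ofReal (4 * Real.exp (-c))) atTop
        (𝓝 (ρ ^ B + B * ENNReal.ofReal (4 * 0))) :=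
      tendsto_const_nhds.add (ENNReal.Tendsto.const_mul
        (ENNReal.tendsto_ofReal (hexp.const_mul 4)) (Or.inr (ENNReal.natCast_ne_top B)))
    simp only [mul_zero, ENNReal.ofReal_zero, add_zero] at hlim
    refine ge_of_tendsto hlim ?_
    filter_upwards [eventually_gt_atTop 0, hexp.eventually_le_const (by norm_num : (0 : ℝ) < 1 / 2)]
      with c hc0 hc
    exact hbound c hc0 hc B
  exact le_antisymm (ge_of_tendsto' (ENNReal.tendsto_pow_atTop_nhds_zero_of_lt_one hρ1) hpow)
    zero_le

lemma cfA_succ_eq {α : ℝ} (hα : α ∈ Set.Ioo (0 : ℝ) 1) (n : ℕ) :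
    cfA α (n + 1) = firstDigit (gaussMap^[n] α) := by
  have : Int.fract α = α := Int.fract_eq_self.2 ⟨hα.1.le, hα.2⟩
  simp only [cfA, gaussIter, this, Nat.add_sub_cancel]
  rfl

lemma mem_CKL_of_frequently_goodIndex {K L : ℕ} {α c : ℝ} (hα : α ∈ Set.Ioo (0 : ℝ) 1)
    (hirr : Irrational α) (hc : 0 < c)
    (h : ∃ᶠ m in atTop,
      goodIndex (Set.Ioo (100 * (K ^ 2 + L ^ 2)) (200 * (K ^ 2 + L ^ 2))) c m α) :
    α ∈ CKL K L := by
  obtain ⟨nk, hmono, hnk⟩ := extraction_of_frequently_atTop h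
  refine ⟨hα, hirr, nk, hmono, c, hc, fun k => ⟨fun n hn hn' => ?_, ?_⟩⟩
  · rw [Nat.sub_add_comm hn', cfA_succ_eq hα]
    exact (hnk k).1 n hn hn'
  · rw [cfA_succ_eq hα]
    exact (hnk k).2

lemma volume_Ioo_diff_CKL {K : ℕ} (hK : 0 < K) (L : ℕ) :
    volume (Set.Ioo (0 : ℝ) 1 \ CKL K L) = 0 := by
  set S := Set.Ioo (100 * (K ^ 2 + L ^ 2)) (200 * (K ^ 2 + L ^ 2))
  have hmem : 100 * (K ^ 2 + L ^ 2) + 1 ∈ S := by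
    have : 0 < K ^ 2 := by positivity
    constructor <;> omega
  have hnull : cylMeasure 0 {x | ∀ c > 0, ∀ᶠ m in atTop, ¬ goodIndex S c m x} = 0 :=
    cylMeasure_eventually_not_goodIndex (Nat.le_add_left 1 _) hmem ⟨le_rfl, zero_le_one⟩
  have heq : cylMeasure 0 = volume.restrict (Set.Ioc (0 : ℝ) 1) := by
    simp [cylMeasure, cylDensity]
  have hirr : volume {x : ℝ | ¬ Irrational x} = 0 := by
    have : {x : ℝ | ¬ Irrational x} = Set.range ((↑) : ℚ → ℝ) := by
      ext x
      simp [Irrational]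
    rw [this]
    exact (Set.countable_range _).measure_zero _
  rw [heq] at hnull
  refine measure_mono_null (t := {x : ℝ | ¬ Irrational x} ∪
    ({x | ∀ c > 0, ∀ᶠ m in atTop, ¬ goodIndex S c m x} ∩ Set.Ioc 0 1)) ?_
    (measure_union_null hirr ?_)
  · rintro x ⟨hx, hxC⟩
    by_cases hxi : Irrational x
    · refine Or.inr ⟨fun c hc => ?_, hx.1, hx.2.le⟩
      by_contra hfreq
      exact hxC (mem_CKL_of_frequently_goodIndex hx hxi hc hfreq)
    · exact Or.inl hxi
  · rwa [Measure.restrict_apply' measurableSet_Ioc] at hnull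

/-- The set `𝒞 = ⋂_{K,L} 𝒞_{K,L}` has full Lebesgue measure in `(0,1)`. -/
theorem statement6 :
    volume (Set.Ioo (0 : ℝ) 1 \
      ⋂ (K : ℕ) (_ : 0 < K) (L : ℕ) (_ : 0 < L), CKL K L) = 0 := by
  rw [Set.sdiff_iInter]
  refine measure_iUnion_null fun K => ?_
  rw [Set.sdiff_iInter]
  refine measure_iUnion_null fun hK => ?_
  rw [Set.sdiff_iInter]
  refine measure_iUnion_null fun L => ?_
  rw [Set.sdiff_iInter]
  exact measure_iUnion_null fun _ => volume_Ioo_diff_CKL hK L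
end
end

section
/- Let α be irrational with convergent denominators (q_n), and let f(x) = -log x - log(1-x) + g(x) with g ∈ C³(𝕋). There exists a constant C' > 0 such that for every n ∈ ℕ and every x ∈ 𝕋 whose q_n-orbit under the rotation by α does not contain 0: |S_{q_n}(f')(x)| < C'·(q_n + 1/x_{n,min}). -/
open MeasureTheory Filter Topology

noncomputable section

/-- `x⁻_{n,min}`: the minimum of `x + jα (mod 1)` over `0 ≤ j < q`. -/
def orbMinus (α x : ℝ) (q : ℕ) : ℝ :=
  sInf ((fun j : ℕ => Int.fract (x + j * α)) '' Set.Iio q)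

/-- `x⁺_{n,min}`: the minimum of `1 - (x + jα (mod 1))` over `0 ≤ j < q`. -/
def orbPlus (α x : ℝ) (q : ℕ) : ℝ :=
  sInf ((fun j : ℕ => 1 - Int.fract (x + j * α)) '' Set.Iio q)

/-- `x_{n,min} = min(x⁻_{n,min}, x⁺_{n,min})`. -/
def orbMin (α x : ℝ) (q : ℕ) : ℝ := min (orbMinus α x q) (orbPlus α x q)

lemma gaussIter_succ (α : ℝ) (n : ℕ) :
    gaussIter α (n + 1) = Int.fract (gaussIter α n)⁻¹ :=
  Function.iterate_succ_apply' _ _ _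

lemma irrational_fract {x : ℝ} (hx : Irrational x) : Irrational (Int.fract x) := by
  rw [← Int.self_sub_floor]
  exact hx.sub_intCast _

lemma irrational_gaussIter {α : ℝ} (hα : Irrational α) (n : ℕ) :
    Irrational (gaussIter α n) := by
  induction n with
  | zero => exact irrational_fract hα
  | succ n ih =>
    rw [gaussIter_succ]
    exact irrational_fract (irrational_inv_iff.mpr ih)

lemma gaussIter_nonneg (α : ℝ) (n : ℕ) : 0 ≤ gaussIter α n := by
  cases n with
  | zero => exact Int.fract_nonneg _
  | succ n => rw [gaussIter_succ]; exact Int.fract_nonneg _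

lemma gaussIter_pos {α : ℝ} (hα : Irrational α) (n : ℕ) : 0 < gaussIter α n :=
  (gaussIter_nonneg α n).lt_of_ne (irrational_gaussIter hα n).ne_zero.symm

lemma gaussIter_lt_one (α : ℝ) (n : ℕ) : gaussIter α n < 1 := by
  cases n with
  | zero => exact Int.fract_lt_one _
  | succ n => rw [gaussIter_succ]; exact Int.fract_lt_one _

lemma cfA_add_gaussIter {α : ℝ} (hα : Irrational α) (n : ℕ) :
    (cfA α (n + 1) + gaussIter α (n + 1)) * gaussIter α n = 1 := by
  have h0 := gaussIter_pos hα n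
  have h : (cfA α (n + 1) : ℝ) + gaussIter α (n + 1) = (gaussIter α n)⁻¹ := by
    rw [gaussIter_succ, cfA, Nat.add_sub_cancel,
      natCast_floor_eq_intCast_floor (inv_nonneg.mpr h0.le), Int.floor_add_fract]
  rw [h, inv_mul_cancel₀ h0.ne']

lemma one_le_cfA {α : ℝ} (hα : Irrational α) (n : ℕ) : 1 ≤ cfA α (n + 1) := by
  have h0 := gaussIter_pos hα n
  rw [cfA, Nat.add_sub_cancel, Nat.one_le_floor_iff]
  exact (one_le_inv₀ h0).mpr (gaussIter_lt_one α n).le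

lemma cfQ_pos {α : ℝ} (hα : Irrational α) (n : ℕ) : 0 < cfQ α n := by
  induction n using Nat.strong_induction_on with
  | _ n ih =>
    match n with
    | 0 => simp [cfQ]
    | 1 => exact one_le_cfA hα 0
    | n + 2 =>
      rw [cfQ]
      have := ih n (by omega)
      omega

lemma cfQ_le_succ {α : ℝ} (hα : Irrational α) (n : ℕ) : cfQ α n ≤ cfQ α (n + 1) := by
  cases n with
  | zero => exact cfQ_pos hα 1
  | succ n =>
    rw [cfQ]
    have := one_le_cfA hα (n + 1)
    nlinarith

/-- The numerators of the convergents of the fractional part of `α`. -/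
def cfP (α : ℝ) : ℕ → ℕ
  | 0 => 0
  | 1 => 1
  | n + 2 => cfA α (n + 2) * cfP α (n + 1) + cfP α n

lemma cfP_mul_cfQ_sub (α : ℝ) (n : ℕ) :
    (cfP α (n + 1) * cfQ α n - cfP α n * cfQ α (n + 1) : ℤ) = (-1) ^ n := by
  induction n with
  | zero => simp [cfP, cfQ]
  | succ n ih =>
    rw [cfP, cfQ, pow_succ, ← ih]
    push_cast
    ring

lemma fract_mul_cfQ_sub_succ {α : ℝ} (hα : Irrational α) (n : ℕ) :
    Int.fract α * cfQ α (n + 1) - cfP α (n + 1)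
      = -gaussIter α (n + 1) * (Int.fract α * cfQ α n - cfP α n) := by
  induction n with
  | zero =>
    have h := cfA_add_gaussIter hα 0
    have h0 : gaussIter α 0 = Int.fract α := rfl
    rw [h0] at h
    simp only [cfQ, cfP, zero_add, Nat.cast_one, Nat.cast_zero] at h ⊢
    linarith
  | succ n ih =>
    have h := cfA_add_gaussIter hα (n + 1)
    rw [cfP, cfQ]
    push_cast
    linear_combination
      (Int.fract α * cfQ α n - cfP α n) * (-h)
        + (cfA α (n + 1 + 1) + gaussIter α (n + 1 + 1)) * ih

lemma abs_fract_mul_cfQ_sub_le {α : ℝ} (hα : Irrational α) (n : ℕ) :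
    |Int.fract α * cfQ α n - cfP α n| * cfQ α n ≤ 1 := by
  set D := Int.fract α * cfQ α n - cfP α n with hD
  have hdet : (cfP α (n + 1) * cfQ α n - cfP α n * cfQ α (n + 1) : ℝ) = (-1) ^ n := by
    exact_mod_cast cfP_mul_cfQ_sub α n
  have hD' := fract_mul_cfQ_sub_succ hα n
  have hx := gaussIter_pos hα (n + 1)
  have hQ : (cfQ α n : ℝ) ≤ cfQ α (n + 1) := by exact_mod_cast cfQ_le_succ hα n
  have h1 : D * (cfQ α (n + 1) + gaussIter α (n + 1) * cfQ α n) = (-1) ^ n := by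
    rw [← hdet, hD]
    linear_combination (cfQ α n : ℝ) * hD'
  have h2 := congrArg abs h1
  have hq : (0 : ℝ) ≤ cfQ α n := Nat.cast_nonneg _
  rw [abs_mul, abs_of_nonneg (a := cfQ α (n + 1) + gaussIter α (n + 1) * cfQ α n)
    (by positivity), abs_pow, abs_neg, abs_one, one_pow] at h2
  rw [← h2]
  gcongr
  nlinarith

/-- Each convergent denominator is the denominator of a reduced fraction that
approximates `α` quadratically. -/
lemma exists_isCoprime_cfQ {α : ℝ} (hα : Irrational α) (n : ℕ) :
    ∃ p : ℤ, IsCoprime p (cfQ α n : ℤ) ∧ |α * cfQ α n - p| * cfQ α n ≤ 1 := by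
  refine ⟨cfP α n + ⌊α⌋ * cfQ α n, ?_, ?_⟩
  · rw [IsCoprime.add_mul_right_left_iff]
    refine ⟨-(-1) ^ n * cfQ α (n + 1), (-1) ^ n * cfP α (n + 1), ?_⟩
    have h : ((-1) ^ n * (-1) ^ n : ℤ) = 1 := by rw [← mul_pow]; simp
    linear_combination (-1) ^ n * cfP_mul_cfQ_sub α n + h
  · convert abs_fract_mul_cfQ_sub_le hα n using 3
    rw [← Int.self_sub_floor]
    push_cast
    ring

lemma sum_range_reindex {p m : ℤ} {q : ℕ} (hq : 0 < q) (hp : IsCoprime p (q : ℤ))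
    (F : ℕ → ℝ) :
    ∑ j ∈ Finset.range q, F ((m + j * p) % q).toNat = ∑ k ∈ Finset.range q, F k := by
  have hq' : (0 : ℤ) < q := by exact_mod_cast hq
  have hmaps : ∀ j ∈ Finset.range q, ((m + j * p) % q).toNat ∈ Finset.range q := by
    intro j _
    rw [Finset.mem_range]
    have := Int.emod_lt_of_pos (m + j * p) hq'
    omega
  have hinj : Set.InjOn (fun j : ℕ => ((m + j * p) % q).toNat) (Finset.range q) := by
    intro i hi j hj hij
    simp only [Finset.coe_range, Set.mem_Iio] at hi hj hij
    have h1 := Int.emod_nonneg (m + i * p) hq'.ne'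
    have h2 := Int.emod_nonneg (m + j * p) hq'.ne'
    have h3 : (m + i * p) % q = (m + j * p) % q := by omega
    have h4 : (q : ℤ) ∣ (i - j : ℤ) * p := by
      have := Int.ModEq.dvd h3.symm
      convert this using 1
      ring
    have h5 : (q : ℤ) ∣ (i - j : ℤ) := hp.symm.dvd_of_dvd_mul_right h4
    have h6 := Int.eq_zero_of_abs_lt_dvd h5 (by rw [abs_lt]; omega)
    omega
  refine Finset.sum_nbij (fun j : ℕ => ((m + j * p) % q).toNat) hmaps hinj ?_ (fun _ _ => rfl)
  exact Finset.surjOn_of_injOn_of_card_le _ hmaps hinj le_rfl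

lemma sum_range_one_div_sq_le (q : ℕ) :
    ∑ k ∈ Finset.range q, 1 / ((k : ℝ) + 1) ^ 2 ≤ 2 := by
  have key : ∀ n : ℕ,
      ∑ k ∈ Finset.range (n + 1), 1 / ((k : ℝ) + 1) ^ 2 ≤ 2 - 1 / ((n : ℝ) + 1) := by
    intro n
    induction n with
    | zero => norm_num
    | succ n ih =>
      rw [Finset.sum_range_succ]
      have h : 1 / (((n + 1 : ℕ) : ℝ) + 1) ^ 2
          ≤ 1 / ((n : ℝ) + 1) - 1 / (((n + 1 : ℕ) : ℝ) + 1) := by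
        push_cast
        rw [div_sub_div _ _ (by positivity) (by positivity),
          div_le_div_iff₀ (by positivity) (by positivity)]
        nlinarith [Nat.cast_nonneg (α := ℝ) n]
      linarith
  cases q with
  | zero => simp
  | succ n =>
    have : (0 : ℝ) ≤ 1 / ((n : ℝ) + 1) := by positivity
    linarith [key n]

lemma sum_range_sub_eq (q : ℕ) (F : ℝ → ℝ) :
    ∑ k ∈ Finset.range q, F ((q : ℝ) - k) = ∑ k ∈ Finset.range q, F ((k : ℝ) + 1) := by
  rw [← Finset.sum_range_reflect]
  refine Finset.sum_congr rfl fun k hk => ?_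
  rw [Finset.mem_range] at hk
  congr 1
  rw [Nat.cast_sub (by omega), Nat.cast_sub (by omega)]
  push_cast
  ring

/-- The error in replacing `1 / y` by `q / (k + 1)` when `y` is within a cell of
`[k / q, (k + 1) / q]` modulo one. -/
def cellError (q k : ℕ) (M : ℝ) : ℝ :=
  9 * q * (1 / ((k : ℝ) + 1) ^ 2) + 9 * q * (1 / ((q : ℝ) - k) ^ 2)
    + if 2 ≤ k ∧ k + 3 ≤ q then 0 else M

lemma abs_one_div_sub_le {q k : ℕ} (hk : k < q) {y e M : ℝ} {z : ℤ} (hy0 : 0 < y)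
    (hy1 : y < 1) (hM : 1 / y ≤ M) (he0 : -1 < e) (he1 : e < 2)
    (hy : y * q = k + e + z * q) :
    |1 / y - q / ((k : ℝ) + 1)| ≤ cellError q k M := by
  have hq : (0 : ℝ) < q := by exact_mod_cast (by omega : 0 < q)
  have hkq : (0 : ℝ) < (q : ℝ) - k := sub_pos.mpr (by exact_mod_cast hk)
  have hA : 0 ≤ 9 * (q : ℝ) * (1 / ((k : ℝ) + 1) ^ 2) := by positivity
  have hB : 0 ≤ 9 * (q : ℝ) * (1 / ((q : ℝ) - k) ^ 2) := by positivity
  have hy' : 0 < 1 / y := by positivity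
  have hc : 0 < (q : ℝ) / ((k : ℝ) + 1) := by positivity
  unfold cellError
  split_ifs with hgood
  · have hk2 : (2 : ℝ) ≤ k := by exact_mod_cast hgood.1
    have hk3 : (k : ℝ) + 3 ≤ q := by exact_mod_cast hgood.2
    have hz : z = 0 := by
      have h1 : (-1 : ℝ) < z := by
        by_contra! h
        nlinarith
      have h2 : (z : ℝ) < 1 := by
        by_contra! h
        nlinarith
      have h3 : -1 < z := by exact_mod_cast h1
      have h4 : z < 1 := by exact_mod_cast h2
      omega
    rw [hz, Int.cast_zero, zero_mul, add_zero] at hy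
    have hyq : 1 / y = q / (k + e) := by
      rw [← hy]
      field_simp
    have hke : (0 : ℝ) < k + e := by linarith
    have : |1 / y - q / ((k : ℝ) + 1)| ≤ 9 * q * (1 / ((k : ℝ) + 1) ^ 2) := by
      have h : 1 / y - q / ((k : ℝ) + 1) = q * ((1 - e) / ((k + e) * (k + 1))) := by
        rw [hyq]
        field_simp
        ring
      rw [h, abs_mul, abs_of_pos hq, abs_div, abs_of_pos (a := (k + e) * ((k : ℝ) + 1))
        (by positivity), mul_comm 9, mul_assoc, mul_one_div]
      refine mul_le_mul_of_nonneg_left ?_ hq.le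
      rw [div_le_div_iff₀ (by positivity) (by positivity)]
      have h2 : |1 - e| ≤ 2 := by rw [abs_le]; constructor <;> linarith
      have h3 : (k : ℝ) + 1 ≤ 3 * (k + e) := by linarith
      have h4 : |1 - e| * (k + 1) ≤ 2 * (3 * (k + e)) :=
        mul_le_mul h2 h3 (by positivity) (by norm_num)
      nlinarith
    linarith
  · have hcq : (q : ℝ) / ((k : ℝ) + 1) ≤ 9 * q * (1 / ((k : ℝ) + 1) ^ 2)
        + 9 * q * (1 / ((q : ℝ) - k) ^ 2) := by
      have hle : (q : ℝ) / ((k : ℝ) + 1) ≤ q :=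
        div_le_self hq.le (by linarith [Nat.cast_nonneg (α := ℝ) k])
      have aux : ∀ r : ℝ, 0 < r → r ≤ 2 → (q : ℝ) ≤ 9 * q * (1 / r ^ 2) := by
        intro r hr hr2
        rw [mul_one_div, le_div_iff₀ (by positivity)]
        have : r ^ 2 ≤ 9 := by nlinarith
        nlinarith
      rcases (by omega : k ≤ 1 ∨ q ≤ k + 2) with h | h
      · have h' : (k : ℝ) ≤ 1 := by exact_mod_cast h
        linarith [aux (k + 1) (by positivity) (by linarith)]
      · have h' : (q : ℝ) ≤ k + 2 := by exact_mod_cast h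
        linarith [aux (q - k) hkq (by linarith)]
    rw [abs_le]
    constructor <;> linarith

lemma cellError_reflect {q k : ℕ} (hk : k < q) (M : ℝ) :
    cellError q (q - 1 - k) M = cellError q k M := by
  have h : ((q - 1 - k : ℕ) : ℝ) = q - 1 - k := by
    rw [Nat.cast_sub (by omega), Nat.cast_sub (by omega), Nat.cast_one]
  unfold cellError
  rw [h]
  have h1 : (2 ≤ q - 1 - k ∧ q - 1 - k + 3 ≤ q) ↔ (2 ≤ k ∧ k + 3 ≤ q) := by omega
  simp only [h1]
  ring_nf

lemma abs_one_div_one_sub_sub_le {q k : ℕ} (hk : k < q) {y e M : ℝ} {z : ℤ} (hy0 : 0 < y)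
    (hy1 : y < 1) (hM : 1 / (1 - y) ≤ M) (he0 : -1 < e) (he1 : e < 2)
    (hy : y * q = k + e + z * q) :
    |1 / (1 - y) - q / ((q : ℝ) - k)| ≤ cellError q k M := by
  have h : ((q - 1 - k : ℕ) : ℝ) = q - 1 - k := by
    rw [Nat.cast_sub (by omega), Nat.cast_sub (by omega), Nat.cast_one]
  rw [← cellError_reflect hk]
  convert abs_one_div_sub_le (q := q) (k := q - 1 - k) (y := 1 - y) (e := 1 - e) (z := -z) (by omega)
    (sub_pos.mpr hy1) (by linarith) hM (by linarith) (by linarith) ?_ using 4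
  · rw [h]; ring
  · rw [h]; push_cast; linarith

lemma sum_cellError_le (q : ℕ) {M : ℝ} (hM : 0 ≤ M) :
    ∑ k ∈ Finset.range q, cellError q k M ≤ 36 * q + 4 * M := by
  have h1 := sum_range_one_div_sq_le q
  have h2 := sum_range_sub_eq q (fun r => 1 / r ^ 2)
  have h3 : ∑ k ∈ Finset.range q, (if 2 ≤ k ∧ k + 3 ≤ q then 0 else M) ≤ 4 * M := by
    calc ∑ k ∈ Finset.range q, (if 2 ≤ k ∧ k + 3 ≤ q then 0 else M)
        ≤ ∑ k ∈ Finset.range q, (if k ∈ ({0, 1, q - 2, q - 1} : Finset ℕ) then M else 0) := by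
          refine Finset.sum_le_sum fun k hk => ?_
          rw [Finset.mem_range] at hk
          split_ifs with ha hb hb
          · exact hM
          · exact le_rfl
          · exact le_rfl
          · simp only [Finset.mem_insert, Finset.mem_singleton] at hb
            omega
      _ ≤ ({0, 1, q - 2, q - 1} : Finset ℕ).card * M := by
          rw [← Finset.sum_filter, Finset.sum_const, nsmul_eq_mul]
          gcongr
          intro k hk
          exact (Finset.mem_filter.mp hk).2
      _ ≤ 4 * M := by
          gcongr
          exact_mod_cast Finset.card_le_four
  simp only [cellError]
  rw [Finset.sum_add_distrib, Finset.sum_add_distrib, ← Finset.mul_sum, ← Finset.mul_sum, h2]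
  have hq : (0 : ℝ) ≤ q := Nat.cast_nonneg q
  nlinarith

/-- Orbits of a rotation close to a rational one give bounded cancellation in the sum of
`1 / (1 - y) - 1 / y`. -/
lemma abs_sum_one_div_sub_le {α x : ℝ} {p : ℤ} {q : ℕ} (hq : 0 < q)
    (hp : IsCoprime p (q : ℤ)) (hα : |α * q - p| * q ≤ 1) {M : ℝ}
    (h0 : ∀ j < q, Int.fract (x + j * α) ≠ 0)
    (hM : ∀ j < q, 1 / Int.fract (x + j * α) ≤ M)
    (hM' : ∀ j < q, 1 / (1 - Int.fract (x + j * α)) ≤ M) :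
    |∑ j ∈ Finset.range q,
      (1 / (1 - Int.fract (x + j * α)) - 1 / Int.fract (x + j * α))| ≤ 72 * q + 8 * M := by
  have hqZ : (0 : ℤ) < q := by exact_mod_cast hq
  have hqR : (0 : ℝ) < q := by exact_mod_cast hq
  have hM0 : 0 ≤ M := le_trans (one_div_nonneg.mpr (Int.fract_nonneg _)) (hM 0 hq)
  set m : ℤ := ⌊x * q⌋ with hm
  set κ : ℕ → ℕ := fun j => ((m + j * p) % q).toNat with hκ
  set T : ℕ → ℝ := fun k => q / ((q : ℝ) - k) - q / ((k : ℝ) + 1) with hT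
  have hT0 : ∑ j ∈ Finset.range q, T (κ j) = 0 := by
    rw [hκ, sum_range_reindex hq hp T, hT, Finset.sum_sub_distrib,
      sum_range_sub_eq q (fun r => q / r), sub_self]
  have hterm : ∀ j ∈ Finset.range q,
      |1 / (1 - Int.fract (x + j * α)) - 1 / Int.fract (x + j * α) - T (κ j)|
        ≤ 2 * cellError q (κ j) M := by
    intro j hj
    rw [Finset.mem_range] at hj
    have hr0 := Int.emod_nonneg (m + j * p) hqZ.ne'
    have hr1 := Int.emod_lt_of_pos (m + j * p) hqZ
    have hκq : κ j < q := by simp only [hκ]; omega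
    have hκR : (κ j : ℝ) = (((m + j * p) % q : ℤ) : ℝ) := by
      have : ((κ j : ℕ) : ℤ) = (m + j * p) % q := Int.toNat_of_nonneg hr0
      rw [← this, Int.cast_natCast]
    have hdiv : (((m + j * p) % q : ℤ) : ℝ) = m + j * p - q * ((m + j * p) / q : ℤ) := by
      rw [Int.emod_def]
      push_cast
      ring
    set y := Int.fract (x + j * α) with hy
    have hy0 : 0 < y := (Int.fract_nonneg _).lt_of_ne (h0 j hj).symm
    have hy1 : y < 1 := Int.fract_lt_one _
    have hδ : |j * (α * q - p)| < 1 := by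
      have hjq : (j : ℝ) < q := by exact_mod_cast hj
      rw [abs_mul, Nat.abs_cast]
      rcases (abs_nonneg (α * q - p)).eq_or_lt with h | h
      · rw [← h]; simp
      · nlinarith
    have hδ' := abs_lt.mp hδ
    have hf0 := Int.fract_nonneg (x * q)
    have hf1 := Int.fract_lt_one (x * q)
    have hf2 := Int.self_sub_floor (x * q)
    have hyq : y * q = κ j + (Int.fract (x * q) + j * (α * q - p))
        + (((m + j * p) / q - ⌊x + j * α⌋ : ℤ) : ℝ) * q := by
      rw [hκR, hdiv, ← hf2, ← hm, hy, ← Int.self_sub_floor]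
      push_cast
      ring
    have h1 := abs_one_div_sub_le hκq hy0 hy1 (hM j hj) (by linarith) (by linarith) hyq
    have h2 := abs_one_div_one_sub_sub_le hκq hy0 hy1 (hM' j hj) (by linarith)
      (by linarith) hyq
    rw [abs_le] at h1 h2 ⊢
    simp only [hT]
    constructor <;> linarith [h1.1, h1.2, h2.1, h2.2]
  calc _ = |∑ j ∈ Finset.range q,
        (1 / (1 - Int.fract (x + j * α)) - 1 / Int.fract (x + j * α) - T (κ j))| := by
        rw [Finset.sum_sub_distrib (g := fun j => T (κ j)), hT0, sub_zero]
    _ ≤ ∑ j ∈ Finset.range q, 2 * cellError q (κ j) M :=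
        (Finset.abs_sum_le_sum_abs _ _).trans (Finset.sum_le_sum hterm)
    _ = 2 * ∑ k ∈ Finset.range q, cellError q k M := by
        rw [← Finset.mul_sum, hκ, sum_range_reindex hq hp (fun k => cellError q k M)]
    _ ≤ 72 * q + 8 * M := by linarith [sum_cellError_le q hM0]

lemma orbMin_pos {α x : ℝ} {q : ℕ} (hq : 0 < q)
    (h0 : ∀ j < q, Int.fract (x + j * α) ≠ 0) : 0 < orbMin α x q := by
  have hne : (Set.Iio q).Nonempty := ⟨0, hq⟩
  have hfin := Set.finite_Iio q
  refine lt_min ?_ ?_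
  · obtain ⟨j, hj, h⟩ := (hne.image (fun j : ℕ => Int.fract (x + j * α))).csInf_mem
      (hfin.image _)
    rw [orbMinus, ← h]
    exact (Int.fract_nonneg _).lt_of_ne (h0 j hj).symm
  · obtain ⟨j, hj, h⟩ := (hne.image (fun j : ℕ => 1 - Int.fract (x + j * α))).csInf_mem
      (hfin.image _)
    rw [orbPlus, ← h]
    exact sub_pos.mpr (Int.fract_lt_one _)

lemma orbMin_le_fract {α x : ℝ} {q j : ℕ} (hj : j < q) :
    orbMin α x q ≤ Int.fract (x + j * α) :=
  (min_le_left _ _).trans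
    (csInf_le ((Set.finite_Iio q).image _).bddBelow (Set.mem_image_of_mem _ hj))

lemma orbMin_le_one_sub_fract {α x : ℝ} {q j : ℕ} (hj : j < q) :
    orbMin α x q ≤ 1 - Int.fract (x + j * α) :=
  (min_le_right _ _).trans
    (csInf_le ((Set.finite_Iio q).image _).bddBelow (Set.mem_image_of_mem _ hj))

lemma exists_abs_deriv_le_of_periodic {g : ℝ → ℝ} (hgper : Function.Periodic g 1)
    (hg : ContDiff ℝ 3 g) : ∃ G : ℝ, 0 ≤ G ∧ ∀ y, |deriv g y| ≤ G := by
  have hper : Function.Periodic (deriv g) 1 := by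
    intro y
    rw [← deriv_comp_add_const, funext hgper]
  have hcont : Continuous (deriv g) := hg.continuous_deriv (by norm_num)
  obtain ⟨G, hG⟩ := (hper.isBounded_of_continuous one_ne_zero hcont).exists_norm_le
  have hG' : ∀ y, |deriv g y| ≤ G := fun y => hG _ (Set.mem_range_self y)
  exact ⟨G, (abs_nonneg _).trans (hG' 0), hG'⟩

/-- For `f(x) = -log x - log(1-x) + g(x)` with `g ∈ C³(𝕋)`, there is
`C' > 0` such that for every `n` and every `x` whose `q_n`-orbit avoids `0`,
`|S_{q_n}(f')(x)| < C'(q_n + 1/x_{n,min})`, where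
`f'(x) = 1/(1-x) - 1/x + g'(x)`. -/
theorem statement7 (α : ℝ) (hα : Irrational α)
    (g : ℝ → ℝ) (hgper : Function.Periodic g 1) (hg : ContDiff ℝ 3 g) :
    ∃ C' > (0 : ℝ), ∀ n : ℕ, ∀ x : ℝ,
      (∀ j : ℕ, j < cfQ α n → Int.fract (x + j * α) ≠ 0) →
      |birkhoffRot α (fun y => 1 / (1 - Int.fract y) - 1 / Int.fract y + deriv g y)
          (cfQ α n) x|
        < C' * (cfQ α n + 1 / orbMin α x (cfQ α n)) := by
  obtain ⟨G, hG0, hG⟩ := exists_abs_deriv_le_of_periodic hgper hg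
  refine ⟨81 + G, by positivity, fun n x h0 => ?_⟩
  have hq := cfQ_pos hα n
  obtain ⟨p, hp, hpα⟩ := exists_isCoprime_cfQ hα n
  set q := cfQ α n
  have hqR : (0 : ℝ) < q := by exact_mod_cast hq
  have hpos := orbMin_pos hq h0
  have hM := abs_sum_one_div_sub_le hq hp hpα h0
    (fun j hj => one_div_le_one_div_of_le hpos (orbMin_le_fract hj))
    (fun j hj => one_div_le_one_div_of_le hpos (orbMin_le_one_sub_fract hj))
  have hMpos : 0 < 1 / orbMin α x q := by positivity
  have hsum : |∑ j ∈ Finset.range q, deriv g (x + j * α)| ≤ q * G := by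
    refine (Finset.abs_sum_le_sum_abs _ _).trans ?_
    refine (Finset.sum_le_sum fun (j : ℕ) _ => hG (x + (j : ℝ) * α)).trans ?_
    simp
  rw [birkhoffRot, Finset.sum_add_distrib]
  refine (abs_add_le _ _).trans_lt ?_
  nlinarith
end
end
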